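/- Let F : ℝ^d → ℝ be differentiable with L-Lipschitz gradient. Fix W ∈ ℝ^d, a mask m ∈ {0,1}^d, and constants δ, ζ ∈ [0,1], σ ≥ 0, and assume: (i) ‖W − W⊙m‖ ≤ δ‖W‖; (ii) ‖∇F(V) − ∇F(V)⊙m‖ ≤ ζ‖∇F(V)‖ for all V ∈ ℝ^d. Let (Ω, μ) be a probability space and g : Ω → ℝ^d a random vector with ∫ g dμ = ∇F(W⊙m) and ∫ ‖g − ∇F(W⊙m)‖² dμ ≤ σ², and assume ω ↦ F(W − η g(ω)⊙m) is integrable. Then for any step size 0 < η ≤ (1−ζ)²/(2L): ∫ F(W − η g⊙m) dμ − F(W) ≤ −(η(1−ζ)²/4)‖∇F(W)‖² − (η(1−ζ)²/4)‖∇F(W⊙m)‖² + (ηL²δ²/2)‖W‖² + (η²Lσ²/2). -/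

import Mathlib

open MeasureTheory

/-- Componentwise (Hadamard) product on `ℝ^d`. -/
noncomputable def hadamard {d : ℕ} (v m : EuclideanSpace ℝ (Fin d)) :
    EuclideanSpace ℝ (Fin d) :=
  (WithLp.equiv 2 (Fin d → ℝ)).symm fun i => v i * m i

/-- A mask is a vector each of whose entries is `0` or `1`. -/
def IsMask {d : ℕ} (m : EuclideanSpace ℝ (Fin d)) : Prop :=
  ∀ i, m i = 0 ∨ m i = 1

section Hadamard

variable {d : ℕ}

lemma hadamard_apply (v m : EuclideanSpace ℝ (Fin d)) (i : Fin d) :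
    hadamard v m i = v i * m i := rfl

lemma hadamard_sub (v w m : EuclideanSpace ℝ (Fin d)) :
    hadamard (v - w) m = hadamard v m - hadamard w m := by
  ext i
  simp [hadamard_apply, sub_mul]

lemma inner_hadamard_right (v w m : EuclideanSpace ℝ (Fin d)) :
    inner ℝ v (hadamard w m) = inner ℝ (hadamard v m) w := by
  simp only [PiLp.inner_apply, hadamard_apply, RCLike.inner_apply, conj_trivial]
  exact Finset.sum_congr rfl fun i _ => by ring

lemma IsMask.hadamard_hadamard {m : EuclideanSpace ℝ (Fin d)} (hm : IsMask m)
    (v : EuclideanSpace ℝ (Fin d)) : hadamard (hadamard v m) m = hadamard v m := by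
  ext i
  rcases hm i with h | h <;> simp [hadamard_apply, h]

lemma IsMask.inner_hadamard_hadamard {m : EuclideanSpace ℝ (Fin d)} (hm : IsMask m)
    (v w : EuclideanSpace ℝ (Fin d)) :
    inner ℝ (hadamard v m) (hadamard w m) = inner ℝ (hadamard v m) w := by
  rw [inner_hadamard_right, hm.hadamard_hadamard]

lemma IsMask.norm_hadamard_le {m : EuclideanSpace ℝ (Fin d)} (hm : IsMask m)
    (v : EuclideanSpace ℝ (Fin d)) : ‖hadamard v m‖ ≤ ‖v‖ := by
  rw [EuclideanSpace.norm_eq, EuclideanSpace.norm_eq]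
  refine Real.sqrt_le_sqrt (Finset.sum_le_sum fun i _ => ?_)
  rcases hm i with h | h <;> simp [hadamard_apply, h, sq_nonneg]

/-- A mask acts as an orthogonal projection, so the squared norm of a masked vector lies below
this expression, which is affine in `v` up to the squared distance to `w`. -/
lemma IsMask.norm_hadamard_sq_le {m : EuclideanSpace ℝ (Fin d)} (hm : IsMask m)
    (v w : EuclideanSpace ℝ (Fin d)) :
    ‖hadamard v m‖ ^ 2 ≤
      ‖v - w‖ ^ 2 + 2 * inner ℝ (hadamard w m) v - ‖hadamard w m‖ ^ 2 := by
  have h₁ := pow_le_pow_left₀ (norm_nonneg _) (hm.norm_hadamard_le (v - w)) 2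
  rw [hadamard_sub, norm_sub_sq_real, real_inner_comm, hm.inner_hadamard_hadamard] at h₁
  linarith

end Hadamard

/-- The descent lemma: a function with `L`-Lipschitz gradient lies below its quadratic
upper model. -/
lemma le_add_inner_add_of_gradient_lipschitz {E : Type*} [NormedAddCommGroup E]
    [InnerProductSpace ℝ E] [CompleteSpace E] {F : E → ℝ} {F' : E → E} {L : ℝ}
    (hgrad : ∀ x, HasGradientAt F (F' x) x)
    (hLip : ∀ x y, ‖F' x - F' y‖ ≤ L * ‖x - y‖) (x v : E) :
    F (x + v) ≤ F x + inner ℝ (F' x) v + L / 2 * ‖v‖ ^ 2 := by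
  let φ : ℝ → ℝ := fun t => F (x + t • v) - t * inner ℝ (F' x) v - t ^ 2 * (L / 2 * ‖v‖ ^ 2)
  have hφ : ∀ t, HasDerivAt φ (inner ℝ (F' (x + t • v)) v - inner ℝ (F' x) v
      - t * (L * ‖v‖ ^ 2)) t := by
    intro t
    have hline : HasDerivAt (fun s : ℝ => x + s • v) v t := by
      simpa using ((hasDerivAt_id t).smul_const v).const_add x
    have hF : HasDerivAt (fun s : ℝ => F (x + s • v)) (inner ℝ (F' (x + t • v)) v) t := by
      simpa [Function.comp_def] using
        (hgrad (x + t • v)).hasFDerivAt.comp_hasDerivAt t hline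
    have h := (hF.sub ((hasDerivAt_id t).mul_const (inner ℝ (F' x) v))).sub
      ((hasDerivAt_pow 2 t).mul_const (L / 2 * ‖v‖ ^ 2))
    refine h.congr_deriv ?_
    push_cast
    ring
  have hanti : AntitoneOn φ (Set.Icc 0 1) := by
    refine antitoneOn_of_deriv_nonpos (convex_Icc 0 1)
      (fun t _ => (hφ t).continuousAt.continuousWithinAt)
      (fun t _ => (hφ t).differentiableAt.differentiableWithinAt) fun t ht => ?_
    rw [interior_Icc] at ht
    rw [(hφ t).deriv, ← inner_sub_left]
    have h₁ := real_inner_le_norm (F' (x + t • v) - F' x) v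
    have h₂ := hLip (x + t • v) x
    rw [add_sub_cancel_left, norm_smul, Real.norm_of_nonneg ht.1.le] at h₂
    have h₃ := mul_le_mul_of_nonneg_right h₂ (norm_nonneg v)
    linarith
  have h := hanti (Set.left_mem_Icc.2 zero_le_one) (Set.right_mem_Icc.2 zero_le_one) zero_le_one
  simp only [φ, one_smul, zero_smul, add_zero] at h
  linarith

/-- The per-iteration expected decrease inequality (global-L2-2) in the proof of the
CHEX convergence theorem, for a single masked stochastic gradient update
`W' = W - η g⊙m`, where `g` has mean `∇F(W⊙m)` and variance at most `σ²`. -/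
theorem chex_per_iteration_decrease {d : ℕ} {Ω : Type*} [MeasurableSpace Ω]
    (μ : Measure Ω) [IsProbabilityMeasure μ]
    (F : EuclideanSpace ℝ (Fin d) → ℝ)
    (F' : EuclideanSpace ℝ (Fin d) → EuclideanSpace ℝ (Fin d))
    (L δ ζ σ : ℝ) (hL : 0 < L) (hσ : 0 ≤ σ)
    (hδ0 : 0 ≤ δ) (hδ1 : δ ≤ 1) (hζ0 : 0 ≤ ζ) (hζ1 : ζ ≤ 1)
    (hgrad : ∀ V, HasGradientAt F (F' V) V)
    (hLip : ∀ V₁ V₂, ‖F' V₁ - F' V₂‖ ≤ L * ‖V₁ - V₂‖)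
    (W m : EuclideanSpace ℝ (Fin d)) (hm : IsMask m)
    (hWδ : ‖W - hadamard W m‖ ≤ δ * ‖W‖)
    (hmζ : ∀ V, ‖F' V - hadamard (F' V) m‖ ≤ ζ * ‖F' V‖)
    (g : Ω → EuclideanSpace ℝ (Fin d))
    (hgint : Integrable g μ)
    (hg2int : Integrable (fun ω => ‖g ω - F' (hadamard W m)‖ ^ 2) μ)
    (hmean : ∫ ω, g ω ∂μ = F' (hadamard W m))
    (hvar : ∫ ω, ‖g ω - F' (hadamard W m)‖ ^ 2 ∂μ ≤ σ ^ 2)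
    (η : ℝ) (hη0 : 0 < η) (hη : η ≤ (1 - ζ) ^ 2 / (2 * L))
    (hFint : Integrable (fun ω => F (W - η • hadamard (g ω) m)) μ) :
    (∫ ω, F (W - η • hadamard (g ω) m) ∂μ) - F W ≤
      -(η * (1 - ζ) ^ 2 / 4) * ‖F' W‖ ^ 2 - η * (1 - ζ) ^ 2 / 4 * ‖F' (hadamard W m)‖ ^ 2 +
        η * L ^ 2 * δ ^ 2 / 2 * ‖W‖ ^ 2 + η ^ 2 * L * σ ^ 2 / 2 := by
  set a := F' W with ha
  set b := F' (hadamard W m) with hb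
  set A := hadamard a m with hA
  set B := hadamard b m with hB
  have hLη : L * η ≤ 1 / 2 := by
    rw [le_div_iff₀ (by positivity)] at hη
    nlinarith
  have hpt : ∀ ω, F (W - η • hadamard (g ω) m) ≤
      (F W - L * η ^ 2 / 2 * ‖B‖ ^ 2) + inner ℝ ((L * η ^ 2) • B - η • A) (g ω)
        + L * η ^ 2 / 2 * ‖g ω - b‖ ^ 2 := by
    intro ω
    have h₁ := le_add_inner_add_of_gradient_lipschitz hgrad hLip W (-(η • hadamard (g ω) m))
    rw [← sub_eq_add_neg, inner_neg_right, inner_smul_right, inner_hadamard_right, norm_neg,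
      norm_smul, Real.norm_of_nonneg hη0.le, mul_pow] at h₁
    have h₂ := mul_le_mul_of_nonneg_left (hm.norm_hadamard_sq_le (g ω) b)
      (by positivity : 0 ≤ L * η ^ 2 / 2)
    rw [inner_sub_left, real_inner_smul_left, real_inner_smul_left]
    linarith
  have hlin : Integrable (fun ω => inner ℝ ((L * η ^ 2) • B - η • A) (g ω)) μ :=
    hgint.const_inner _
  have hint : ∫ ω, F (W - η • hadamard (g ω) m) ∂μ ≤
      (F W - L * η ^ 2 / 2 * ‖B‖ ^ 2) + inner ℝ ((L * η ^ 2) • B - η • A) b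
        + L * η ^ 2 / 2 * ∫ ω, ‖g ω - b‖ ^ 2 ∂μ := by
    have hsum : Integrable (fun ω => (F W - L * η ^ 2 / 2 * ‖B‖ ^ 2)
        + inner ℝ ((L * η ^ 2) • B - η • A) (g ω)) μ := (integrable_const _).add hlin
    refine (integral_mono hFint (hsum.add (hg2int.const_mul _)) hpt).trans_eq ?_
    rw [integral_add' hsum (hg2int.const_mul _),
      integral_add (integrable_const _) hlin, integral_const_mul,
      integral_inner hgint, hmean]
    simp
  have hBb : inner ℝ B b = ‖B‖ ^ 2 := by
    rw [← hm.inner_hadamard_hadamard, real_inner_self_eq_norm_sq]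
  have hAb : inner ℝ A b = (‖A‖ ^ 2 + ‖B‖ ^ 2 - ‖A - B‖ ^ 2) / 2 := by
    rw [← hm.inner_hadamard_hadamard, norm_sub_sq_real]
    ring
  rw [inner_sub_left, real_inner_smul_left, real_inner_smul_left, hBb, hAb] at hint
  have hAB : ‖A - B‖ ^ 2 ≤ L ^ 2 * δ ^ 2 * ‖W‖ ^ 2 := by
    have h : ‖A - B‖ ≤ L * (δ * ‖W‖) := by
      rw [hA, hB, ← hadamard_sub]
      exact (hm.norm_hadamard_le _).trans ((hLip _ _).trans (by gcongr))
    calc ‖A - B‖ ^ 2 ≤ (L * (δ * ‖W‖)) ^ 2 := by gcongr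
      _ = L ^ 2 * δ ^ 2 * ‖W‖ ^ 2 := by ring
  have hmask : ∀ V, (1 - ζ) ^ 2 * ‖F' V‖ ^ 2 ≤ ‖hadamard (F' V) m‖ ^ 2 := by
    intro V
    rw [← mul_pow]
    refine pow_le_pow_left₀ (mul_nonneg (sub_nonneg.2 hζ1) (norm_nonneg _)) ?_ 2
    linarith [hmζ V, norm_sub_norm_le (F' V) (hadamard (F' V) m)]
  have hvar' := mul_le_mul_of_nonneg_left hvar (by positivity : 0 ≤ L * η ^ 2 / 2)
  have hAB' := mul_le_mul_of_nonneg_left hAB (by positivity : 0 ≤ η / 2)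
  have hA' := mul_le_mul_of_nonneg_left (hmask W) (by positivity : 0 ≤ η / 4)
  have hB' := mul_le_mul_of_nonneg_left (hmask (hadamard W m)) (by positivity : 0 ≤ η / 4)
  have hstep := mul_le_mul_of_nonneg_right hLη (by positivity : 0 ≤ η / 2 * ‖B‖ ^ 2)
  have hApos : 0 ≤ η / 4 * ‖A‖ ^ 2 := by positivity
  rw [← ha, ← hA] at hA'
  rw [← hb, ← hB] at hB'
  linarith
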